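/- (Sturm comparison theorem.) Assume p, q₁, q₂, r satisfy Hypothesis 2.1 on (a,b) ⊆ ℝ, fix λ ∈ ℝ and x₀ ∈ (a,b), and for j = 1,2 let (u_j, v_j) be a real-valued solution of τ_j u_j = λ u_j, where τ_j = r(x)^(−1)[−(d/dx) p(x)(d/dx) + q_j(x)]. If q₂ ≥ q₁ a.e. on (a,b), u₁(x) ≠ 0 for all x ∈ (a,b) \ {x₀}, u₂(x₀) = u₁(x₀), and v₂(x₀) = v₁(x₀), then |u₂(x)| ≥ |u₁(x)| for all x ∈ (a,b); in particular u₂(x) ≠ 0 for all x ∈ (a,b) \ {x₀}. -/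

import Mathlib

noncomputable section

open MeasureTheory Set
open scoped ENNReal NNReal

/-- The open interval `(a, b) ⊆ ℝ` with extended-real endpoints. -/
def IabE (a b : EReal) : Set ℝ := {x : ℝ | a < (x : EReal) ∧ (x : EReal) < b}

/-- Hypothesis 2.1 for the Sturm–Liouville expression
`τ = r(x)⁻¹ [-(d/dx) p(x) (d/dx) + q(x)]` on `(a, b)`. -/
structure Hyp21 (a b : EReal) (p q r : ℝ → ℝ) : Prop where
  hab : a < b
  p_meas : Measurable p
  q_meas : Measurable q
  r_meas : Measurable r
  r_pos : ∀ᵐ x : ℝ, x ∈ IabE a b → 0 < r x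
  r_loc : LocallyIntegrableOn r (IabE a b)
  p_pos : ∀ᵐ x : ℝ, x ∈ IabE a b → 0 < p x
  invp_loc : LocallyIntegrableOn (fun x => 1 / p x) (IabE a b)
  q_loc : LocallyIntegrableOn q (IabE a b)

/-- `(u, v)` is a real-valued solution of `τ u = λ u` on `(a, b)`, where
`τ = r(x)⁻¹ [-(d/dx) p(x) (d/dx) + q(x)]` and `v` plays the role of the
quasi-derivative `u^[1] = p u'`. -/
def IsSolution3R (a b : EReal) (p q r : ℝ → ℝ) (lam : ℝ) (u v : ℝ → ℝ) : Prop :=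
  ∀ x ∈ IabE a b, ∀ x₀ ∈ IabE a b,
    (u x = u x₀ + ∫ t in x₀..x, v t / p t) ∧
    (v x = v x₀ + ∫ t in x₀..x, (q t - lam * r t) * u t)

/-- `(u, v)` is a complex-valued solution of `τ u = z u` on `(a, b)`. -/
def IsSolution3C (a b : EReal) (p q r : ℝ → ℝ) (z : ℂ) (u v : ℝ → ℂ) : Prop :=
  ∀ x ∈ IabE a b, ∀ x₀ ∈ IabE a b,
    (u x = u x₀ + ∫ t in x₀..x, v t / (p t : ℂ)) ∧
    (v x = v x₀ + ∫ t in x₀..x, ((q t : ℂ) - z * (r t : ℂ)) * u t)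

/-- `τ` is in the limit point case at `a`: for every `z ∈ ℂ` there is a solution of
`τ u = z u` with `∫_a^c |u|² r dx = ∞` for some `c ∈ (a, b)`. -/
def LimitPointAtA (a b : EReal) (p q r : ℝ → ℝ) : Prop :=
  ∀ z : ℂ, ∃ u v : ℝ → ℂ, IsSolution3C a b p q r z u v ∧
    ∃ c : ℝ, c ∈ IabE a b ∧
      (∫⁻ x in IabE a (c : EReal),
        (‖u x‖₊ : ℝ≥0∞) ^ 2 * ENNReal.ofReal (r x)) = ⊤

/-- `τ` is in the limit circle case at `a`: for every `z ∈ ℂ` every solution of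
`τ u = z u` satisfies `∫_a^c |u|² r dx < ∞` for some `c ∈ (a, b)`. -/
def LimitCircleAtA (a b : EReal) (p q r : ℝ → ℝ) : Prop :=
  ∀ z : ℂ, ∀ u v : ℝ → ℂ, IsSolution3C a b p q r z u v →
    ∃ c : ℝ, c ∈ IabE a b ∧
      (∫⁻ x in IabE a (c : EReal),
        (‖u x‖₊ : ℝ≥0∞) ^ 2 * ENNReal.ofReal (r x)) < ⊤

/-- `τ` is nonoscillatory at `a`: some nontrivial real-valued solution of `τ u = 0`
has finitely many zeros in `(a, c)` for some `c ∈ (a, b)`. -/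
def NonoscillatoryAtA (a b : EReal) (p q r : ℝ → ℝ) : Prop :=
  ∃ u v : ℝ → ℝ, IsSolution3R a b p q r 0 u v ∧
    (¬ ∀ x ∈ IabE a b, u x = 0 ∧ v x = 0) ∧
    ∃ c : ℝ, c ∈ IabE a b ∧ {x ∈ IabE a (c : EReal) | u x = 0}.Finite

open Filter Topology

/-- A function that varies no more than a constant times an absolutely continuous one is
absolutely continuous. -/
theorem AbsolutelyContinuousOnInterval.of_dist_le_mul {f g : ℝ → ℝ} {a b : ℝ} (K : ℝ)
    (hf : AbsolutelyContinuousOnInterval f a b)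
    (h : ∀ x ∈ uIcc a b, ∀ y ∈ uIcc a b, dist (g x) (g y) ≤ K * dist (f x) (f y)) :
    AbsolutelyContinuousOnInterval g a b := by
  have hlim := Tendsto.const_mul K hf
  rw [mul_zero] at hlim
  refine squeeze_zero' (Eventually.of_forall fun E => Finset.sum_nonneg fun _ _ => dist_nonneg)
    ?_ hlim
  filter_upwards [mem_inf_of_right (mem_principal_self _)] with E hE
  rw [Finset.mul_sum]
  exact Finset.sum_le_sum fun i hi => h _ (hE.1 i hi).1 _ (hE.1 i hi).2

/-- The inverse of a positive absolutely continuous function is absolutely continuous. -/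
theorem AbsolutelyContinuousOnInterval.inv_of_pos {f : ℝ → ℝ} {a b : ℝ}
    (hf : AbsolutelyContinuousOnInterval f a b) (hpos : ∀ x ∈ uIcc a b, 0 < f x) :
    AbsolutelyContinuousOnInterval (fun x => (f x)⁻¹) a b := by
  obtain ⟨m, hm, hmin⟩ := isCompact_uIcc.exists_isMinOn nonempty_uIcc hf.continuousOn
  have hm0 := hpos m hm
  refine hf.of_dist_le_mul ((f m)⁻¹ * (f m)⁻¹) fun x hx y hy => ?_
  have hx0 := hpos x hx
  have hy0 := hpos y hy
  have hxm : f m ≤ f x := hmin hx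
  have hym : f m ≤ f y := hmin hy
  rw [dist_inv_inv₀ hx0.ne' hy0.ne', Real.norm_of_nonneg hx0.le, Real.norm_of_nonneg hy0.le,
    div_eq_inv_mul, mul_inv]
  gcongr

/-- An absolutely continuous function whose derivative is nonnegative almost everywhere takes a
larger value at the right endpoint than at the left one. -/
theorem AbsolutelyContinuousOnInterval.le_of_ae_deriv_nonneg {f f' : ℝ → ℝ} {a b : ℝ}
    (hf : AbsolutelyContinuousOnInterval f a b) (hab : a ≤ b)
    (hderiv : ∀ᵐ x : ℝ, x ∈ Icc a b → HasDerivAt f (f' x) x)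
    (hnonneg : ∀ᵐ x : ℝ, x ∈ Icc a b → 0 ≤ f' x) : f a ≤ f b := by
  rw [← sub_nonneg, ← hf.integral_deriv_eq_sub]
  refine intervalIntegral.integral_nonneg_of_ae_restrict hab ?_
  rw [EventuallyLE, ae_restrict_iff' measurableSet_Icc]
  filter_upwards [hderiv, hnonneg] with x hx hx' hmem
  rw [(hx hmem).deriv]
  exact hx' hmem

/-- A function on an open interval whose increments are all given by the (possibly junk-valued)
integrals of a fixed function is continuous. -/
theorem continuousOn_of_eq_add_intervalIntegral {f g : ℝ → ℝ} {s : Set ℝ} (hs : IsOpen s)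
    (hc : s.OrdConnected) (h : ∀ x ∈ s, ∀ y ∈ s, g y = g x + ∫ t in x..y, f t) :
    ContinuousOn g s := by
  by_cases hint : ∀ x ∈ s, ∀ y ∈ s, IntervalIntegrable f volume x y
  · intro x hx
    obtain ⟨ε, hε, hball⟩ := Metric.isOpen_iff.1 hs x hx
    have hl : x - ε / 2 ∈ s := hball (by
      rw [Metric.mem_ball, Real.dist_eq, abs_lt]; constructor <;> linarith)
    have hr : x + ε / 2 ∈ s := hball (by
      rw [Metric.mem_ball, Real.dist_eq, abs_lt]; constructor <;> linarith)
    have hmem : x ∈ uIcc (x - ε / 2) (x + ε / 2) := by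
      rw [uIcc_of_le (by linarith)]; constructor <;> linarith
    have hprim := intervalIntegral.continuousOn_primitive_interval' (hint _ hl _ hr) hmem
    have hg : ContinuousOn g (uIcc (x - ε / 2) (x + ε / 2)) :=
      (continuousOn_const.add hprim).congr fun y hy => h x hx y (hc.uIcc_subset hl hr hy)
    rw [uIcc_of_le (by linarith)] at hg
    exact (hg.continuousAt (Icc_mem_nhds (by linarith) (by linarith))).continuousWithinAt
  · push Not at hint
    obtain ⟨x, hx, y, hy, hxy⟩ := hint
    have hconst : ∀ z ∈ s, g z = g x := by
      intro z hz
      by_cases hxz : IntervalIntegrable f volume x z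
      · have hyz : ¬ IntervalIntegrable f volume y z := fun hyz => hxy (hxz.trans hyz.symm)
        have h₁ := h x hx y hy
        have h₂ := h y hy z hz
        rw [intervalIntegral.integral_undef hxy] at h₁
        rw [intervalIntegral.integral_undef hyz] at h₂
        linarith
      · have h₁ := h x hx z hz
        rwa [intervalIntegral.integral_undef hxz, add_zero] at h₁
    exact continuousOn_const.congr hconst

/-- A function given on `[a, b]` by integrals of `f'` is absolutely continuous, with derivative
`f'` almost everywhere. -/
theorem absolutelyContinuousOnInterval_of_eq_add_intervalIntegral {f f' : ℝ → ℝ} {a b : ℝ}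
    (hab : a ≤ b) (hint : IntervalIntegrable f' volume a b)
    (h : ∀ x ∈ Icc a b, f x = f a + ∫ t in a..x, f' t) :
    AbsolutelyContinuousOnInterval f a b ∧
      ∀ᵐ x : ℝ, x ∈ Icc a b → HasDerivAt f (f' x) x := by
  constructor
  · refine (hint.absolutelyContinuousOnInterval_intervalIntegral left_mem_uIcc).of_dist_le_mul 1
      fun x hx y hy => ?_
    rw [uIcc_of_le hab] at hx hy
    rw [h x hx, h y hy, dist_add_left, one_mul]
  · have ha : ∀ᵐ x : ℝ, x ≠ a := by simp [ae_iff, measure_singleton]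
    have hb : ∀ᵐ x : ℝ, x ≠ b := by simp [ae_iff, measure_singleton]
    filter_upwards [hint.ae_hasDerivAt_integral, ha, hb] with x hx hxa hxb hmem
    have hd := (hx (by rwa [uIcc_of_le hab]) a left_mem_uIcc).const_add (f a)
    refine hd.congr_of_eventuallyEq ?_
    filter_upwards [Icc_mem_nhds (lt_of_le_of_ne hmem.1 hxa.symm) (lt_of_le_of_ne hmem.2 hxb)]
      with y hy using h y hy

/-- `(u, v)` is a continuous solution on `s` of the first-order system `u' = P v`, `v' = A u` with
locally integrable coefficients, in integrated form. -/
structure IsSystemSolution (P A u v : ℝ → ℝ) (s : Set ℝ) : Prop where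
  ordConnected : s.OrdConnected
  intervalIntegrable_P : ∀ x ∈ s, ∀ y ∈ s, IntervalIntegrable P volume x y
  intervalIntegrable_A : ∀ x ∈ s, ∀ y ∈ s, IntervalIntegrable A volume x y
  continuousOn_u : ContinuousOn u s
  continuousOn_v : ContinuousOn v s
  eq_u : ∀ x ∈ s, ∀ y ∈ s, u y = u x + ∫ t in x..y, P t * v t
  eq_v : ∀ x ∈ s, ∀ y ∈ s, v y = v x + ∫ t in x..y, A t * u t

namespace IsSystemSolution

variable {P A u v A₁ u₁ v₁ A₂ u₂ v₂ : ℝ → ℝ} {s : Set ℝ} {x₀ x y : ℝ}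

theorem neg (h : IsSystemSolution P A u v s) :
    IsSystemSolution P A (fun x => -u x) (fun x => -v x) s where
  ordConnected := h.ordConnected
  intervalIntegrable_P := h.intervalIntegrable_P
  intervalIntegrable_A := h.intervalIntegrable_A
  continuousOn_u := h.continuousOn_u.neg
  continuousOn_v := h.continuousOn_v.neg
  eq_u x hx y hy := by
    simp only [mul_neg, intervalIntegral.integral_neg]
    linarith [h.eq_u x hx y hy]
  eq_v x hx y hy := by
    simp only [mul_neg, intervalIntegral.integral_neg]
    linarith [h.eq_v x hx y hy]

theorem reflect (h : IsSystemSolution P A u v s) :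
    IsSystemSolution (fun x => P (-x)) (fun x => A (-x)) (fun x => u (-x)) (fun x => -v (-x))
      {x | -x ∈ s} where
  ordConnected := ⟨fun x hx y hy z hz =>
    h.ordConnected.out hy hx ⟨neg_le_neg hz.2, neg_le_neg hz.1⟩⟩
  intervalIntegrable_P x hx y hy := by
    have := (IntervalIntegrable.iff_comp_neg (by simp)).1 (h.intervalIntegrable_P _ hx _ hy)
    simpa using this
  intervalIntegrable_A x hx y hy := by
    have := (IntervalIntegrable.iff_comp_neg (by simp)).1 (h.intervalIntegrable_A _ hx _ hy)
    simpa using this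
  continuousOn_u := h.continuousOn_u.comp continuous_neg.continuousOn fun _ hx => hx
  continuousOn_v := (h.continuousOn_v.comp continuous_neg.continuousOn fun _ hx => hx).neg
  eq_u x hx y hy := by
    have := h.eq_u _ hx _ hy
    simp only [mul_neg, intervalIntegral.integral_neg,
      intervalIntegral.integral_comp_neg fun t => P t * v t]
    rw [this, intervalIntegral.integral_symm (-y)]
  eq_v x hx y hy := by
    have := h.eq_v _ hx _ hy
    rw [intervalIntegral.integral_comp_neg fun t => A t * u t, this,
      intervalIntegral.integral_symm (-y)]
    ring

theorem intervalIntegrable_mul_v (h : IsSystemSolution P A u v s) (hx : x ∈ s) (hy : y ∈ s) :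
    IntervalIntegrable (fun t => P t * v t) volume x y :=
  (h.intervalIntegrable_P x hx y hy).mul_continuousOn
    (h.continuousOn_v.mono (h.ordConnected.uIcc_subset hx hy))

theorem intervalIntegrable_mul_u (h : IsSystemSolution P A u v s) (hx : x ∈ s) (hy : y ∈ s) :
    IntervalIntegrable (fun t => A t * u t) volume x y :=
  (h.intervalIntegrable_A x hx y hy).mul_continuousOn
    (h.continuousOn_u.mono (h.ordConnected.uIcc_subset hx hy))

theorem absolutelyContinuous_u (h : IsSystemSolution P A u v s) (hx : x ∈ s) (hy : y ∈ s)
    (hxy : x ≤ y) : AbsolutelyContinuousOnInterval u x y ∧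
      ∀ᵐ t : ℝ, t ∈ Icc x y → HasDerivAt u (P t * v t) t :=
  absolutelyContinuousOnInterval_of_eq_add_intervalIntegral hxy
    (h.intervalIntegrable_mul_v hx hy) fun t ht => h.eq_u x hx t (h.ordConnected.out hx hy ht)

theorem absolutelyContinuous_v (h : IsSystemSolution P A u v s) (hx : x ∈ s) (hy : y ∈ s)
    (hxy : x ≤ y) : AbsolutelyContinuousOnInterval v x y ∧
      ∀ᵐ t : ℝ, t ∈ Icc x y → HasDerivAt v (A t * u t) t :=
  absolutelyContinuousOnInterval_of_eq_add_intervalIntegral hxy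
    (h.intervalIntegrable_mul_u hx hy) fun t ht => h.eq_v x hx t (h.ordConnected.out hx hy ht)

/-- A solution with vanishing initial data has zeros to the right of the initial point. -/
theorem exists_eq_zero_of_initial_eq_zero (h : IsSystemSolution P A u v s) (hx₀ : x₀ ∈ s)
    (hy : y ∈ s) (hlt : x₀ < y) (hu : u x₀ = 0) (hv : v x₀ = 0) : ∃ t ∈ Ioc x₀ y, u t = 0 := by
  have hsub : Icc x₀ y ⊆ s := h.ordConnected.out hx₀ hy
  have hint : ∀ z ∈ s, IntervalIntegrable (fun t => |P t| + |A t|) volume x₀ z := fun z hz =>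
    (h.intervalIntegrable_P x₀ hx₀ z hz).abs.add (h.intervalIntegrable_A x₀ hx₀ z hz).abs
  obtain ⟨c, hc, hsmall⟩ : ∃ c ∈ Ioc x₀ y, ∫ t in x₀..c, (|P t| + |A t|) < 1 / 2 := by
    have hcont := intervalIntegral.continuousOn_primitive_interval' (hint y hy) left_mem_uIcc
    rw [uIcc_of_le hlt.le] at hcont
    have hlim := (hcont x₀ (left_mem_Icc.2 hlt.le)).mono Ioc_subset_Icc_self
    have hev : ∀ᶠ c in 𝓝[Ioc x₀ y] x₀, ∫ t in x₀..c, (|P t| + |A t|) < 1 / 2 :=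
      hlim.eventually_lt continuousWithinAt_const (by simp)
    rw [nhdsWithin_Ioc_eq_nhdsGT hlt] at hev
    obtain ⟨c, hc, hmem⟩ := (hev.and (Ioc_mem_nhdsGT hlt)).exists
    exact ⟨c, hmem, hc⟩
  have hcs : Icc x₀ c ⊆ s := (Icc_subset_Icc_right hc.2).trans hsub
  obtain ⟨m, hm, hmax⟩ := isCompact_Icc.exists_isMaxOn (nonempty_Icc.2 hc.1.le)
    ((h.continuousOn_u.mono hcs).abs.add (h.continuousOn_v.mono hcs).abs)
  set M := |u m| + |v m| with hM
  have hM0 : 0 ≤ M := by positivity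
  have hle : ∀ t ∈ Icc x₀ c, |u t| + |v t| ≤ M := fun t ht => hmax ht
  have hms : m ∈ s := hcs hm
  have hcmem : c ∈ s := hcs (right_mem_Icc.2 hc.1.le)
  have hbound : M ≤ M * ∫ t in x₀..m, (|P t| + |A t|) := by
    have e₁ : |u m| ≤ ∫ t in x₀..m, |P t * v t| := by
      rw [h.eq_u x₀ hx₀ m hms, hu, zero_add]
      exact intervalIntegral.abs_integral_le_integral_abs hm.1
    have e₂ : |v m| ≤ ∫ t in x₀..m, |A t * u t| := by
      rw [h.eq_v x₀ hx₀ m hms, hv, zero_add]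
      exact intervalIntegral.abs_integral_le_integral_abs hm.1
    have i₁ := (h.intervalIntegrable_mul_v hx₀ hms).abs
    have i₂ := (h.intervalIntegrable_mul_u hx₀ hms).abs
    refine (add_le_add e₁ e₂).trans ?_
    rw [← intervalIntegral.integral_add i₁ i₂, ← intervalIntegral.integral_const_mul]
    refine intervalIntegral.integral_mono_on hm.1 (i₁.add i₂) ((hint m hms).const_mul M)
      fun t ht => ?_
    have ht' := hle t ⟨ht.1, ht.2.trans hm.2⟩
    have hut : |u t| ≤ M := by linarith [abs_nonneg (v t)]
    have hvt : |v t| ≤ M := by linarith [abs_nonneg (u t)]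
    rw [abs_mul, abs_mul, mul_add, mul_comm M, mul_comm M]
    gcongr
  have hmono : ∫ t in x₀..m, (|P t| + |A t|) ≤ ∫ t in x₀..c, (|P t| + |A t|) :=
    intervalIntegral.integral_mono_interval le_rfl hm.1 hm.2
      (Eventually.of_forall fun t => by positivity) (hint c hcmem)
  have hM_zero : M = 0 := by nlinarith
  refine ⟨c, hc, abs_eq_zero.1 (le_antisymm ?_ (abs_nonneg _))⟩
  linarith [hle c (right_mem_Icc.2 hc.1.le), abs_nonneg (v c)]

/-- A solution positive to the right of `x₀` has either a positive value or a positive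
quasi-derivative at `x₀`. -/
theorem initial_pos (h : IsSystemSolution P A u v s) (hP : ∀ᵐ t : ℝ, t ∈ s → 0 ≤ P t)
    (hx₀ : x₀ ∈ s) (hy : y ∈ s) (hlt : x₀ < y) (hpos : ∀ t ∈ Ioc x₀ y, 0 < u t) :
    0 < u x₀ ∨ u x₀ = 0 ∧ 0 < v x₀ := by
  have hsub : Icc x₀ y ⊆ s := h.ordConnected.out hx₀ hy
  have hu₀ : 0 ≤ u x₀ := by
    have hlim := (h.continuousOn_u.mono hsub x₀ (left_mem_Icc.2 hlt.le)).mono Ioc_subset_Icc_self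
    have : (𝓝[Ioc x₀ y] x₀).NeBot := by
      rw [nhdsWithin_Ioc_eq_nhdsGT hlt]; infer_instance
    refine ge_of_tendsto hlim ?_
    filter_upwards [self_mem_nhdsWithin] with t ht using (hpos t ht).le
  rcases hu₀.lt_or_eq with hu₀ | hu₀
  · exact Or.inl hu₀
  refine Or.inr ⟨hu₀.symm, ?_⟩
  rcases lt_trichotomy (v x₀) 0 with hv | hv | hv
  · have hlim := h.continuousOn_v.mono hsub x₀ (left_mem_Icc.2 hlt.le)
    have hev := hlim.eventually_lt continuousWithinAt_const hv
    rw [nhdsWithin_Icc_eq_nhdsGE hlt, eventually_iff, mem_nhdsGE_iff_exists_Icc_subset] at hev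
    obtain ⟨d, hd, hdsub⟩ := hev
    have hd' : x₀ < min d y := lt_min hd hlt
    have hmem : min d y ∈ s := hsub ⟨hd'.le, min_le_right _ _⟩
    have heq := h.eq_u x₀ hx₀ _ hmem
    have hneg : 0 ≤ ∫ t in x₀..min d y, -(P t * v t) := by
      refine intervalIntegral.integral_nonneg_of_ae_restrict hd'.le ?_
      rw [EventuallyLE, ae_restrict_iff' measurableSet_Icc]
      filter_upwards [hP] with t ht htm
      have hPt := ht (h.ordConnected.out hx₀ hmem htm)
      have hvt : v t < 0 := hdsub ⟨htm.1, htm.2.trans (min_le_left _ _)⟩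
      simp only [Pi.zero_apply]
      nlinarith
    rw [intervalIntegral.integral_neg] at hneg
    linarith [hpos _ ⟨hd', min_le_right _ _⟩]
  · obtain ⟨t, ht, htz⟩ := h.exists_eq_zero_of_initial_eq_zero hx₀ hy hlt hu₀.symm hv
    exact absurd htz (hpos t ht).ne'
  · exact hv

/-- Solutions with the same initial data at `x₀`, the first one positive to the right of `x₀`,
have a quotient whose lower limit at `x₀` is at least one. -/
theorem eventually_mul_le (h₁ : IsSystemSolution P A₁ u₁ v₁ s)
    (h₂ : IsSystemSolution P A₂ u₂ v₂ s) (hP : ∀ᵐ t : ℝ, t ∈ s → 0 ≤ P t)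
    (hx₀ : x₀ ∈ s) (hy : y ∈ s) (hlt : x₀ < y) (hpos : ∀ t ∈ Ioc x₀ y, 0 < u₁ t)
    (hu : u₂ x₀ = u₁ x₀) (hv : v₂ x₀ = v₁ x₀) {k : ℝ} (hk : k < 1) :
    ∀ᶠ t in 𝓝[>] x₀, k * u₁ t ≤ u₂ t := by
  have hsub : Icc x₀ y ⊆ s := h₁.ordConnected.out hx₀ hy
  have hmem₀ := left_mem_Icc.2 hlt.le
  rcases h₁.initial_pos hP hx₀ hy hlt hpos with hu₁ | ⟨hu₁, hv₁⟩
  · have hlim : ContinuousWithinAt (fun t => k * u₁ t) (Icc x₀ y) x₀ :=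
      (h₁.continuousOn_u.mono hsub x₀ hmem₀).const_mul k
    have hev := hlim.eventually_lt (h₂.continuousOn_u.mono hsub x₀ hmem₀) (by rw [hu]; nlinarith)
    rw [nhdsWithin_Icc_eq_nhdsGE hlt] at hev
    filter_upwards [nhdsWithin_mono _ Ioi_subset_Ici_self hev] with t ht using le_of_lt ht
  · have hlim : ContinuousWithinAt (fun t => k * v₁ t) (Icc x₀ y) x₀ :=
      (h₁.continuousOn_v.mono hsub x₀ hmem₀).const_mul k
    have hev := hlim.eventually_lt (h₂.continuousOn_v.mono hsub x₀ hmem₀) (by rw [hv]; nlinarith)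
    rw [nhdsWithin_Icc_eq_nhdsGE hlt, eventually_iff, mem_nhdsGE_iff_exists_Icc_subset] at hev
    obtain ⟨d, hd, hdsub⟩ := hev
    filter_upwards [Ioc_mem_nhdsGT hd, Ioc_mem_nhdsGT hlt] with t htd hty
    have hts : t ∈ s := hsub (Ioc_subset_Icc_self hty)
    have i₁ := (h₁.intervalIntegrable_mul_v hx₀ hts).const_mul k
    have i₂ := h₂.intervalIntegrable_mul_v hx₀ hts
    have hnn : 0 ≤ ∫ z in x₀..t, (P z * v₂ z - k * (P z * v₁ z)) := by
      refine intervalIntegral.integral_nonneg_of_ae_restrict hty.1.le ?_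
      rw [EventuallyLE, ae_restrict_iff' measurableSet_Icc]
      filter_upwards [hP] with z hz hzm
      have hPz := hz (h₁.ordConnected.out hx₀ hts hzm)
      have hvz : k * v₁ z < v₂ z := hdsub ⟨hzm.1, hzm.2.trans htd.2⟩
      simp only [Pi.zero_apply]
      nlinarith
    rw [intervalIntegral.integral_sub i₂ i₁, intervalIntegral.integral_const_mul] at hnn
    rw [h₁.eq_u x₀ hx₀ t hts, h₂.eq_u x₀ hx₀ t hts, hu, hu₁]
    linarith

/-- The Wronskian of two solutions with the same initial data at `x₀` is nonnegative as long as
both solutions are, if the coefficients are ordered. -/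
theorem wronskian_nonneg (h₁ : IsSystemSolution P A₁ u₁ v₁ s)
    (h₂ : IsSystemSolution P A₂ u₂ v₂ s) (hA : ∀ᵐ t : ℝ, t ∈ s → A₁ t ≤ A₂ t)
    (hx₀ : x₀ ∈ s) (hy : y ∈ s) (hle : x₀ ≤ y) (hpos₁ : ∀ t ∈ Ioo x₀ y, 0 ≤ u₁ t)
    (hpos₂ : ∀ t ∈ Ioo x₀ y, 0 ≤ u₂ t) (hu : u₂ x₀ = u₁ x₀) (hv : v₂ x₀ = v₁ x₀) :
    0 ≤ u₁ y * v₂ y - v₁ y * u₂ y := by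
  have hu₁ := h₁.absolutelyContinuous_u hx₀ hy hle
  have hv₁ := h₁.absolutelyContinuous_v hx₀ hy hle
  have hu₂ := h₂.absolutelyContinuous_u hx₀ hy hle
  have hv₂ := h₂.absolutelyContinuous_v hx₀ hy hle
  have hne₁ : ∀ᵐ t : ℝ, t ≠ x₀ := by simp [ae_iff, measure_singleton]
  have hne₂ : ∀ᵐ t : ℝ, t ≠ y := by simp [ae_iff, measure_singleton]
  have hmono := ((hu₁.1.mul hv₂.1).sub (hv₁.1.mul hu₂.1)).le_of_ae_deriv_nonneg
    (f' := fun t => (A₂ t - A₁ t) * (u₁ t * u₂ t)) hle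
    (by
      filter_upwards [hu₁.2, hv₁.2, hu₂.2, hv₂.2] with t d₁ e₁ d₂ e₂ ht
      refine (((d₁ ht).mul (e₂ ht)).sub ((e₁ ht).mul (d₂ ht))).congr_deriv ?_
      ring)
    (by
      filter_upwards [hA, hne₁, hne₂] with t hAt ht₁ ht₂ ht
      have hmem : t ∈ Ioo x₀ y := ⟨lt_of_le_of_ne ht.1 ht₁.symm, lt_of_le_of_ne ht.2 ht₂⟩
      exact mul_nonneg (sub_nonneg.2 (hAt (h₁.ordConnected.out hx₀ hy ht)))
        (mul_nonneg (hpos₁ t hmem) (hpos₂ t hmem)))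
  simp only [Pi.sub_apply, Pi.mul_apply, hu, hv] at hmono
  linarith

/-- Comparison of two solutions with the same initial data, as long as the second one does not
change sign. -/
theorem le_of_nonneg (h₁ : IsSystemSolution P A₁ u₁ v₁ s)
    (h₂ : IsSystemSolution P A₂ u₂ v₂ s) (hP : ∀ᵐ t : ℝ, t ∈ s → 0 ≤ P t)
    (hA : ∀ᵐ t : ℝ, t ∈ s → A₁ t ≤ A₂ t) (hx₀ : x₀ ∈ s) (hy : y ∈ s) (hlt : x₀ < y)
    (hpos₁ : ∀ t ∈ Ioc x₀ y, 0 < u₁ t) (hpos₂ : ∀ t ∈ Ioo x₀ y, 0 ≤ u₂ t)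
    (hu : u₂ x₀ = u₁ x₀) (hv : v₂ x₀ = v₁ x₀) : u₁ y ≤ u₂ y := by
  have hquot : ∀ x ∈ Ioc x₀ y, u₂ x * (u₁ x)⁻¹ ≤ u₂ y * (u₁ y)⁻¹ := by
    intro x hx
    have hxs : x ∈ s := h₁.ordConnected.out hx₀ hy (Ioc_subset_Icc_self hx)
    have hu₁ := h₁.absolutelyContinuous_u hxs hy hx.2
    have hu₂ := h₂.absolutelyContinuous_u hxs hy hx.2
    have hp : ∀ t ∈ Icc x y, 0 < u₁ t := fun t ht => hpos₁ t ⟨hx.1.trans_le ht.1, ht.2⟩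
    refine (hu₂.1.mul (hu₁.1.inv_of_pos (by rwa [uIcc_of_le hx.2]))).le_of_ae_deriv_nonneg
      (f' := fun t => P t * (u₁ t * v₂ t - v₁ t * u₂ t) / u₁ t ^ 2) hx.2 ?_ ?_
    · filter_upwards [hu₁.2, hu₂.2] with t d₁ d₂ ht
      refine ((d₂ ht).mul ((d₁ ht).inv (hp t ht).ne')).congr_deriv ?_
      have := (hp t ht).ne'
      simp only [Pi.inv_apply]
      field_simp
      ring
    · filter_upwards [hP] with t hPt ht
      have hts : t ∈ s := h₁.ordConnected.out hxs hy ht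
      refine div_nonneg (mul_nonneg (hPt hts) ?_) (sq_nonneg _)
      exact h₁.wronskian_nonneg h₂ hA hx₀ hts (hx.1.le.trans ht.1)
        (fun z hz => (hpos₁ z ⟨hz.1, hz.2.le.trans ht.2⟩).le)
        (fun z hz => hpos₂ z ⟨hz.1, hz.2.trans_le ht.2⟩) hu hv
  have hy₀ : 0 < u₁ y := hpos₁ y (right_mem_Ioc.2 hlt)
  have hone : 1 ≤ u₂ y * (u₁ y)⁻¹ := by
    refine le_of_forall_lt fun k hk => ?_
    obtain ⟨l, hkl, hl⟩ := exists_between hk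
    obtain ⟨x, hx, hxmem⟩ := ((h₁.eventually_mul_le h₂ hP hx₀ hy hlt hpos₁ hu hv hl).and
      (Ioc_mem_nhdsGT hlt)).exists
    refine hkl.trans_le (le_trans ?_ (hquot x hxmem))
    rwa [← div_eq_mul_inv, le_div_iff₀ (hpos₁ x hxmem)]
  rwa [← div_eq_mul_inv, one_le_div hy₀] at hone

/-- Sturm comparison to the right of `x₀` for a positive solution. -/
theorem le_of_pos (h₁ : IsSystemSolution P A₁ u₁ v₁ s)
    (h₂ : IsSystemSolution P A₂ u₂ v₂ s) (hP : ∀ᵐ t : ℝ, t ∈ s → 0 ≤ P t)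
    (hA : ∀ᵐ t : ℝ, t ∈ s → A₁ t ≤ A₂ t) (hx₀ : x₀ ∈ s) (hy : y ∈ s) (hlt : x₀ < y)
    (hpos : ∀ t ∈ Ioc x₀ y, 0 < u₁ t) (hu : u₂ x₀ = u₁ x₀) (hv : v₂ x₀ = v₁ x₀) :
    u₁ y ≤ u₂ y := by
  have hsub : Icc x₀ y ⊆ s := h₁.ordConnected.out hx₀ hy
  refine h₁.le_of_nonneg h₂ hP hA hx₀ hy hlt hpos (fun w hw => ?_) hu hv
  by_contra! hneg
  have hev := h₁.eventually_mul_le h₂ hP hx₀ hy hlt hpos hu hv one_half_lt_one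
  rw [eventually_iff, mem_nhdsGT_iff_exists_Ioc_subset] at hev
  obtain ⟨d, hd, hdsub⟩ := hev
  have hstart : ∀ t ∈ Ioc x₀ d, t ≤ y → 0 < u₂ t := fun t ht hty =>
    lt_of_lt_of_le (by have := hpos t ⟨ht.1, hty⟩; positivity) (hdsub ht)
  have hdw : d < w := by
    by_contra! hwd
    exact hneg.not_ge (hstart w ⟨hw.1, hwd⟩ hw.2.le).le
  have hcont : ContinuousOn u₂ (Icc d w) :=
    h₂.continuousOn_u.mono ((Icc_subset_Icc (le_of_lt hd) hw.2.le).trans hsub)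
  have hclosed : IsCompact (Icc d w ∩ u₂ ⁻¹' Iic 0) :=
    isCompact_Icc.of_isClosed_subset (hcont.preimage_isClosed_of_isClosed isClosed_Icc isClosed_Iic)
      inter_subset_left
  obtain ⟨c, ⟨hc, hc₀⟩, hleast⟩ := hclosed.exists_isLeast ⟨w, right_mem_Icc.2 hdw.le, hneg.le⟩
  have hxc : x₀ < c := lt_of_lt_of_le hd hc.1
  have hcy : c ≤ y := hc.2.trans hw.2.le
  have hle := h₁.le_of_nonneg h₂ hP hA hx₀ (hsub ⟨hxc.le, hcy⟩) hxc
    (fun t ht => hpos t ⟨ht.1, ht.2.trans hcy⟩)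
    (fun t ht => by
      by_contra! hlt₀
      rcases le_or_gt t d with htd | htd
      · exact hlt₀.not_ge (hstart t ⟨ht.1, htd⟩ (ht.2.le.trans hcy)).le
      · exact ht.2.not_ge (hleast ⟨⟨htd.le, ht.2.le.trans hc.2⟩, hlt₀.le⟩)) hu hv
  exact (hpos c ⟨hxc, hcy⟩).not_ge (hle.trans hc₀)

/-- Sturm comparison to the right of `x₀`. -/
theorem abs_le_abs_of_lt (h₁ : IsSystemSolution P A₁ u₁ v₁ s)
    (h₂ : IsSystemSolution P A₂ u₂ v₂ s) (hP : ∀ᵐ t : ℝ, t ∈ s → 0 ≤ P t)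
    (hA : ∀ᵐ t : ℝ, t ∈ s → A₁ t ≤ A₂ t) (hx₀ : x₀ ∈ s) (hy : y ∈ s) (hlt : x₀ < y)
    (hne : ∀ t ∈ Ioc x₀ y, u₁ t ≠ 0) (hu : u₂ x₀ = u₁ x₀) (hv : v₂ x₀ = v₁ x₀) :
    |u₁ y| ≤ |u₂ y| := by
  have hsub : Ioc x₀ y ⊆ s := Ioc_subset_Icc_self.trans (h₁.ordConnected.out hx₀ hy)
  rcases isPreconnected_Ioc.mapsTo_Ioi_or_Iio (h₁.continuousOn_u.mono hsub) (b := 0) hne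
    with hpos | hneg
  · have hle := h₁.le_of_pos h₂ hP hA hx₀ hy hlt (fun t ht => hpos ht) hu hv
    have hy₀ : 0 < u₁ y := hpos (right_mem_Ioc.2 hlt)
    exact abs_le_abs_of_nonneg hy₀.le hle
  · have hle := h₁.neg.le_of_pos h₂.neg hP hA hx₀ hy hlt
      (fun t ht => neg_pos.2 (hneg ht)) (by rw [hu]) (by rw [hv])
    have hy₀ : u₁ y < 0 := hneg (right_mem_Ioc.2 hlt)
    rw [← abs_neg, ← abs_neg (u₂ y)]
    exact abs_le_abs_of_nonneg (neg_pos.2 hy₀).le hle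

/-- Sturm comparison on both sides of `x₀`. -/
theorem abs_le_abs (h₁ : IsSystemSolution P A₁ u₁ v₁ s)
    (h₂ : IsSystemSolution P A₂ u₂ v₂ s) (hP : ∀ᵐ t : ℝ, t ∈ s → 0 ≤ P t)
    (hA : ∀ᵐ t : ℝ, t ∈ s → A₁ t ≤ A₂ t) (hx₀ : x₀ ∈ s) (hy : y ∈ s)
    (hne : ∀ t ∈ s, t ≠ x₀ → u₁ t ≠ 0) (hu : u₂ x₀ = u₁ x₀) (hv : v₂ x₀ = v₁ x₀) :
    |u₁ y| ≤ |u₂ y| := by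
  rcases lt_trichotomy x₀ y with hlt | rfl | hlt
  · exact h₁.abs_le_abs_of_lt h₂ hP hA hx₀ hy hlt
      (fun t ht => hne t (h₁.ordConnected.out hx₀ hy (Ioc_subset_Icc_self ht)) ht.1.ne') hu hv
  · rw [hu]
  · have hq := (Measure.measurePreserving_neg (volume : Measure ℝ)).quasiMeasurePreserving
    have hle := h₁.reflect.abs_le_abs_of_lt h₂.reflect (x₀ := -x₀) (y := -y)
      (hq.ae hP) (hq.ae hA) (by simpa using hx₀) (by simpa using hy) (neg_lt_neg hlt)
      (fun t ht => hne (-t)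
        (h₁.ordConnected.out hy hx₀ ⟨le_neg.2 ht.2, (neg_lt.2 ht.1).le⟩) (neg_lt.2 ht.1).ne)
      (by simpa using hu) (by simpa using hv)
    simpa using hle

end IsSystemSolution

theorem isOpen_IabE (a b : EReal) : IsOpen (IabE a b) :=
  isOpen_Ioo.preimage continuous_coe_real_ereal

theorem ordConnected_IabE (a b : EReal) : (IabE a b).OrdConnected :=
  ⟨fun _ hx _ hy _ hz => ⟨hx.1.trans_le (EReal.coe_le_coe_iff.2 hz.1),
    (EReal.coe_le_coe_iff.2 hz.2).trans_lt hy.2⟩⟩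

theorem MeasureTheory.LocallyIntegrableOn.intervalIntegrable {f : ℝ → ℝ} {s : Set ℝ}
    (hf : LocallyIntegrableOn f s) (hs : s.OrdConnected) {x y : ℝ} (hx : x ∈ s) (hy : y ∈ s) :
    IntervalIntegrable f volume x y :=
  (hf.integrableOn_compact_subset (hs.uIcc_subset hx hy) isCompact_uIcc).intervalIntegrable

theorem IsSolution3R.isSystemSolution {a b : EReal} {p q r : ℝ → ℝ} {lam : ℝ} {u v : ℝ → ℝ}
    (hyp : Hyp21 a b p q r) (hsol : IsSolution3R a b p q r lam u v) :
    IsSystemSolution (fun t => 1 / p t) (fun t => q t - lam * r t) u v (IabE a b) where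
  ordConnected := ordConnected_IabE a b
  intervalIntegrable_P _ hx _ hy := hyp.invp_loc.intervalIntegrable (ordConnected_IabE a b) hx hy
  intervalIntegrable_A _ hx _ hy :=
    (hyp.q_loc.intervalIntegrable (ordConnected_IabE a b) hx hy).sub
      ((hyp.r_loc.intervalIntegrable (ordConnected_IabE a b) hx hy).const_mul lam)
  continuousOn_u := continuousOn_of_eq_add_intervalIntegral (isOpen_IabE a b)
    (ordConnected_IabE a b) fun x hx y hy => (hsol y hy x hx).1
  continuousOn_v := continuousOn_of_eq_add_intervalIntegral (isOpen_IabE a b)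
    (ordConnected_IabE a b) fun x hx y hy => (hsol y hy x hx).2
  eq_u x hx y hy := by
    simpa only [one_div_mul_eq_div] using (hsol y hy x hx).1
  eq_v x hx y hy := (hsol y hy x hx).2

theorem statement4 (a b : EReal) (p q₁ q₂ r : ℝ → ℝ)
    (hyp₁ : Hyp21 a b p q₁ r) (hyp₂ : Hyp21 a b p q₂ r)
    (lam : ℝ) (x₀ : ℝ) (hx₀ : x₀ ∈ IabE a b)
    (u₁ v₁ u₂ v₂ : ℝ → ℝ)
    (hsol₁ : IsSolution3R a b p q₁ r lam u₁ v₁)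
    (hsol₂ : IsSolution3R a b p q₂ r lam u₂ v₂)
    (hq : ∀ᵐ x : ℝ, x ∈ IabE a b → q₁ x ≤ q₂ x)
    (hu₁ : ∀ x ∈ IabE a b, x ≠ x₀ → u₁ x ≠ 0)
    (hu₀ : u₂ x₀ = u₁ x₀) (hv₀ : v₂ x₀ = v₁ x₀) :
    (∀ x ∈ IabE a b, |u₁ x| ≤ |u₂ x|) ∧
    (∀ x ∈ IabE a b, x ≠ x₀ → u₂ x ≠ 0) := by
  have h₁ := hsol₁.isSystemSolution hyp₁
  have h₂ := hsol₂.isSystemSolution hyp₂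
  have hP : ∀ᵐ t : ℝ, t ∈ IabE a b → 0 ≤ 1 / p t := by
    filter_upwards [hyp₁.p_pos] with t ht hmem using one_div_nonneg.2 (ht hmem).le
  have hA : ∀ᵐ t : ℝ, t ∈ IabE a b → q₁ t - lam * r t ≤ q₂ t - lam * r t := by
    filter_upwards [hq] with t ht hmem using sub_le_sub_right (ht hmem) _
  have hle : ∀ x ∈ IabE a b, |u₁ x| ≤ |u₂ x| := fun x hx =>
    h₁.abs_le_abs h₂ hP hA hx₀ hx hu₁ hu₀ hv₀
  exact ⟨hle, fun x hx hne =>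
    abs_pos.1 ((abs_pos.2 (hu₁ x hx hne)).trans_le (hle x hx))⟩
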